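/- Let X be an obstruction for local tournament orientation completions whose underlying graph U(X) has a straight enumeration v1,...,vn and a dividing cut-vertex. If v_c is the first dividing cut-vertex in the enumeration, then either c = 2 and v1, v2 are the endvertices of one arc of X, or c = 4 and v2, v3 are the endvertices of an arc, in which case v1,v2,v3,v4 induce in U(X) the graph with edges v1v2, v2v3, v3v4, v2v4. -/

import Mathlib

variable {V : Type*}

/-- The forcing relation Γ on ordered pairs of adjacent vertices. -/
def Gamma (G : SimpleGraph V) (p q : V × V) : Prop :=
  (p.1 = q.1 ∧ p.2 = q.2) ∨
  (p.1 = q.2 ∧ p.2 ≠ q.1 ∧ ¬ G.Adj p.2 q.1) ∨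
  (p.2 = q.1 ∧ p.1 ≠ q.2 ∧ ¬ G.Adj p.1 q.2)

/-- Γ*: there is a Γ-sequence from one pair to another. -/
def GammaStar (G : SimpleGraph V) : V × V → V × V → Prop :=
  Relation.ReflTransGen (Gamma G)

/-- `D` is an orientation of `G` that is a local tournament. -/
def IsLocalTournamentOrientation (G : SimpleGraph V) (D : V → V → Prop) : Prop :=
  (∀ u v, D u v → G.Adj u v) ∧
  (∀ u v, G.Adj u v → (D u v ∨ D v u)) ∧
  (∀ u v, D u v → ¬ D v u) ∧
  (∀ u v w, D u v → D u w → v ≠ w → G.Adj v w) ∧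
  (∀ u v w, D v u → D w u → v ≠ w → G.Adj v w)

/-- `A` is a set of arcs partially orienting `G`. -/
def IsPartialOrientation (G : SimpleGraph V) (A : V → V → Prop) : Prop :=
  (∀ u v, A u v → G.Adj u v) ∧ (∀ u v, A u v → ¬ A v u)

/-- The partially oriented graph `(G, A)` can be completed to a local tournament. -/
def CompletesToLocalTournament (G : SimpleGraph V) (A : V → V → Prop) : Prop :=
  ∃ D, IsLocalTournamentOrientation G D ∧ ∀ u v, A u v → D u v

/-- An obstruction for local tournament orientation completions. -/
def IsObstruction (G : SimpleGraph V) (A : V → V → Prop) : Prop :=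
  IsPartialOrientation G A ∧
  ¬ CompletesToLocalTournament G A ∧
  (∀ v : V, CompletesToLocalTournament (G.induce {u | u ≠ v})
      (fun a b => A a.1 b.1)) ∧
  (∀ a b, A a b →
    CompletesToLocalTournament G (fun u v => A u v ∧ ¬(u = a ∧ v = b)))

/-- A cut-vertex: deleting it increases the number of connected components. -/
def IsCutVertex (G : SimpleGraph V) (v : V) : Prop :=
  Nat.card G.ConnectedComponent <
    Nat.card ((G.induce {u | u ≠ v}).ConnectedComponent)

/-- `v` is the `(x,y)`-balancing vertex: the unique vertex (other than `x,y`)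
adjacent to exactly one of `x, y`. -/
def IsArcBalancingFor (G : SimpleGraph V) (x y v : V) : Prop :=
  v ≠ x ∧ v ≠ y ∧ Xor' (G.Adj v x) (G.Adj v y) ∧
  ∀ w, w ≠ x → w ≠ y → Xor' (G.Adj w x) (G.Adj w y) → w = v

/-- A cut-vertex c is dividing (w.r.t. the enumeration and the two arcs) if
one arc is incident with a vertex preceding c and the other with a vertex
succeeding c. -/
def IsDividing {n : ℕ} (a₁ b₁ a₂ b₂ c : Fin n) : Prop :=
  ((a₁ < c ∨ b₁ < c) ∧ (c < a₂ ∨ c < b₂)) ∨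
  ((a₂ < c ∨ b₂ < c) ∧ (c < a₁ ∨ c < b₁))

/-- An orientation of `G - z`, as a relation on all vertices, which is a local tournament. -/
structure OrMinus {n : ℕ} (G : SimpleGraph (Fin n)) (z : Fin n) (E : Fin n → Fin n → Prop) :
    Prop where
  adj : ∀ u v, E u v → G.Adj u v ∧ u ≠ z ∧ v ≠ z
  tot : ∀ u v, G.Adj u v → u ≠ z → v ≠ z → (E u v ∨ E v u)
  asym : ∀ u v, E u v → ¬ E v u
  out : ∀ u v w, E u v → E u w → v ≠ w → G.Adj v w
  inn : ∀ u v w, E v u → E w u → v ≠ w → G.Adj v w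

theorem exists_orMinus {n : ℕ} {G : SimpleGraph (Fin n)} {A : Fin n → Fin n → Prop}
    (hobs : IsObstruction G A) (z : Fin n) :
    ∃ E, OrMinus G z E ∧ ∀ u v, A u v → u ≠ z → v ≠ z → E u v := by
  obtain ⟨D, ⟨d1, d2, d3, d4, d5⟩, hA⟩ := hobs.2.2.1 z
  refine ⟨fun u v => ∃ (hu : u ≠ z) (hv : v ≠ z), D ⟨u, hu⟩ ⟨v, hv⟩, ⟨?_, ?_, ?_, ?_, ?_⟩, ?_⟩
  · rintro u v ⟨hu, hv, h⟩
    exact ⟨d1 _ _ h, hu, hv⟩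
  · intro u v h hu hv
    rcases d2 ⟨u, hu⟩ ⟨v, hv⟩ h with h | h
    · exact Or.inl ⟨hu, hv, h⟩
    · exact Or.inr ⟨hv, hu, h⟩
  · rintro u v ⟨hu, hv, h⟩ ⟨_, _, h'⟩
    exact d3 _ _ h h'
  · rintro u v w ⟨hu, hv, h⟩ ⟨_, hw, h'⟩ hne
    exact d4 _ _ _ h h' (fun e => hne (congrArg Subtype.val e))
  · rintro u v w ⟨hv, hu, h⟩ ⟨hw, _, h'⟩ hne
    exact d5 _ _ _ h h' (fun e => hne (congrArg Subtype.val e))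
  · intro u v h hu hv
    exact ⟨hu, hv, hA ⟨u, hu⟩ ⟨v, hv⟩ h⟩

theorem obstruction_flip {n : ℕ} {G : SimpleGraph (Fin n)} {A : Fin n → Fin n → Prop}
    (hobs : IsObstruction G A) : IsObstruction G (fun u v => A v u) := by
  have key : ∀ {W : Type} (H : SimpleGraph W) (B : W → W → Prop),
      CompletesToLocalTournament H B → CompletesToLocalTournament H (fun u v => B v u) := by
    rintro W H B ⟨D, ⟨d1, d2, d3, d4, d5⟩, hA⟩
    exact ⟨fun u v => D v u, ⟨fun u v h => (d1 _ _ h).symm, fun u v h => (d2 _ _ h).symm,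
      fun u v h h' => d3 _ _ h h', fun u v w h h' => d5 _ _ _ h h',
      fun u v w h h' => d4 _ _ _ h h'⟩, fun u v h => hA _ _ h⟩
  obtain ⟨⟨p1, p2⟩, h1, h2, h3⟩ := hobs
  refine ⟨⟨fun u v h => (p1 _ _ h).symm, fun u v h => p2 _ _ h⟩, fun h => h1 (key _ _ h),
    fun v => key _ _ (h2 v), fun a b h => ?_⟩
  have := key _ _ (h3 b a h)
  obtain ⟨D, hD, hA⟩ := this
  exact ⟨D, hD, fun u v ⟨x, y⟩ => hA u v ⟨x, fun e => y ⟨e.2, e.1⟩⟩⟩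

theorem obstruction_consec {n : ℕ} {G : SimpleGraph (Fin n)} {A : Fin n → Fin n → Prop}
    (hobs : IsObstruction G A)
    (humb : ∀ u v w : Fin n, u < v → v < w → G.Adj u w → G.Adj u v ∧ G.Adj v w)
    (i j : Fin n) (hij : (j : ℕ) = i + 1) : G.Adj i j := by
  by_contra hna
  have hcr : ∀ u w, u ≤ i → j ≤ w → ¬ G.Adj u w := by
    intro u w hu hw h
    have h1 : G.Adj u j := by
      rcases eq_or_lt_of_le hw with e | e
      · rwa [e]
      · exact (humb u j w (by omega) e h).1
    rcases eq_or_lt_of_le hu with e | e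
    · exact hna (e ▸ h1)
    · exact hna (humb u i j e (by omega) h1).2
  have hcr' : ∀ u w, G.Adj u w → (u ≤ i ∧ w ≤ i) ∨ (j ≤ u ∧ j ≤ w) := by
    intro u w h
    by_contra hc
    by_cases h1 : u ≤ i
    · exact hcr u w h1 (by omega) h
    · exact hcr w u (by omega) (by omega) h.symm
  obtain ⟨E, hE, hAE⟩ := exists_orMinus hobs j
  obtain ⟨F, hF, hAF⟩ := exists_orMinus hobs i
  apply hobs.2.1
  refine ⟨fun u v => (u ≤ i ∧ v ≤ i ∧ E u v) ∨ (j ≤ u ∧ j ≤ v ∧ F u v),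
    ⟨?_, ?_, ?_, ?_, ?_⟩, ?_⟩
  · rintro u v (⟨_, _, h⟩ | ⟨_, _, h⟩)
    · exact (hE.adj _ _ h).1
    · exact (hF.adj _ _ h).1
  · intro u v h
    rcases hcr' u v h with ⟨h1, h2⟩ | ⟨h1, h2⟩
    · rcases hE.tot u v h (by omega) (by omega) with h | h
      · exact Or.inl (Or.inl ⟨h1, h2, h⟩)
      · exact Or.inr (Or.inl ⟨h2, h1, h⟩)
    · rcases hF.tot u v h (by omega) (by omega) with h | h
      · exact Or.inl (Or.inr ⟨h1, h2, h⟩)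
      · exact Or.inr (Or.inr ⟨h2, h1, h⟩)
  · rintro u v (⟨_, _, h⟩ | ⟨_, _, h⟩) (⟨_, _, h'⟩ | ⟨_, _, h'⟩)
    · exact hE.asym _ _ h h'
    · omega
    · omega
    · exact hF.asym _ _ h h'
  · rintro u v w (⟨_, _, h⟩ | ⟨_, _, h⟩) (⟨_, _, h'⟩ | ⟨_, _, h'⟩) hne
    · exact hE.out _ _ _ h h' hne
    · omega
    · omega
    · exact hF.out _ _ _ h h' hne
  · rintro u v w (⟨_, _, h⟩ | ⟨_, _, h⟩) (⟨_, _, h'⟩ | ⟨_, _, h'⟩) hne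
    · exact hE.inn _ _ _ h h' hne
    · omega
    · omega
    · exact hF.inn _ _ _ h h' hne
  · intro u v h
    rcases hcr' u v (hobs.1.1 _ _ h) with ⟨h1, h2⟩ | ⟨h1, h2⟩
    · exact Or.inl ⟨h1, h2, hAE u v h (by omega) (by omega)⟩
    · exact Or.inr ⟨h1, h2, hAF u v h (by omega) (by omega)⟩

theorem reach_induce {n : ℕ} {G : SimpleGraph (Fin n)}
    (hcon : ∀ i j : Fin n, (j : ℕ) = i + 1 → G.Adj i j) (c : Fin n) :
    ∀ (d : ℕ) (x y : Fin n) (hx : x ≠ c) (hy : y ≠ c), (y : ℕ) = x + d →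
      (∀ t : Fin n, x ≤ t → t ≤ y → t ≠ c) →
      (G.induce {u | u ≠ c}).Reachable ⟨x, hx⟩ ⟨y, hy⟩ := by
  intro d
  induction d with
  | zero =>
    intro x y hx hy h _
    have : x = y := by ext; omega
    subst this
    exact SimpleGraph.Reachable.refl _
  | succ d ih =>
    intro x y hx hy h ht
    have hlt : (x : ℕ) + d < n := by have := y.2; omega
    have hm : (⟨x + d, hlt⟩ : Fin n) ≠ c :=
      ht _ (by rw [Fin.le_def]; simp) (by rw [Fin.le_def]; simp only; omega)
    have h1 := ih x ⟨x + d, hlt⟩ hx hm rfl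
      (fun t h1 h2 => ht t h1 (by rw [Fin.le_def] at *; simp only at *; omega))
    refine h1.trans (SimpleGraph.Adj.reachable ?_)
    exact hcon ⟨x + d, hlt⟩ y (by simp only; omega)

theorem reach_all {n : ℕ} {G : SimpleGraph (Fin n)}
    (hcon : ∀ i j : Fin n, (j : ℕ) = i + 1 → G.Adj i j) :
    ∀ (d : ℕ) (x y : Fin n), (y : ℕ) = x + d → G.Reachable x y := by
  intro d
  induction d with
  | zero =>
    intro x y h
    have : x = y := by ext; omega
    subst this
    exact SimpleGraph.Reachable.refl _
  | succ d ih =>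
    intro x y h
    have hlt : (x : ℕ) + d < n := by have := y.2; omega
    have h1 := ih x ⟨x + d, hlt⟩ rfl
    refine h1.trans (SimpleGraph.Adj.reachable ?_)
    exact hcon ⟨x + d, hlt⟩ y (by simp only; omega)

theorem cut_no_cross {n : ℕ} {G : SimpleGraph (Fin n)}
    (hcon : ∀ i j : Fin n, (j : ℕ) = i + 1 → G.Adj i j) (c : Fin n)
    (hcut : IsCutVertex G c) (u w : Fin n) (hu : u < c) (hw : c < w) : ¬ G.Adj u w := by
  intro h
  have huc : u ≠ c := by omega
  have hwc : w ≠ c := by omega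
  have huw : (G.induce {u | u ≠ c}).Reachable ⟨u, huc⟩ ⟨w, hwc⟩ :=
    SimpleGraph.Adj.reachable h
  have hall : ∀ x : {u : Fin n | u ≠ c}, (G.induce {u | u ≠ c}).Reachable x ⟨u, huc⟩ := by
    rintro ⟨x, hx⟩
    have hx' : x ≠ c := hx
    rcases lt_or_gt_of_ne hx' with h1 | h1
    · rcases le_total x u with h2 | h2
      · exact reach_induce hcon c (u - x) x u hx huc (by omega) (by intros; omega)
      · exact (reach_induce hcon c (x - u) u x huc hx (by omega) (by intros; omega)).symm
    · refine SimpleGraph.Reachable.trans ?_ huw.symm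
      rcases le_total x w with h2 | h2
      · exact reach_induce hcon c (w - x) x w hx hwc (by omega) (by intros; omega)
      · exact (reach_induce hcon c (x - w) w x hwc hx (by omega) (by intros; omega)).symm
  have hsub : Subsingleton (G.induce {u | u ≠ c}).ConnectedComponent := by
    constructor
    intro p q
    induction p using SimpleGraph.ConnectedComponent.ind with | _ p
    induction q using SimpleGraph.ConnectedComponent.ind with | _ q
    exact SimpleGraph.ConnectedComponent.sound ((hall p).trans (hall q).symm)
  have h1 : Nat.card (G.induce {u | u ≠ c}).ConnectedComponent ≤ 1 :=
    Finite.card_le_one_iff_subsingleton.2 hsub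
  have : Nonempty G.ConnectedComponent := ⟨G.connectedComponentMk c⟩
  have h2 : 0 < Nat.card G.ConnectedComponent := Nat.card_pos
  unfold IsCutVertex at hcut
  omega

theorem cut_of_no_cross {n : ℕ} {G : SimpleGraph (Fin n)}
    (hcon : ∀ i j : Fin n, (j : ℕ) = i + 1 → G.Adj i j) (a v c : Fin n)
    (hav : a < v) (hvc : v < c)
    (hno : ∀ u w, u < v → v < w → ¬ G.Adj u w) : IsCutVertex G v := by
  have hsub : Subsingleton G.ConnectedComponent := by
    constructor
    intro p q
    induction p using SimpleGraph.ConnectedComponent.ind with | _ p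
    induction q using SimpleGraph.ConnectedComponent.ind with | _ q
    apply SimpleGraph.ConnectedComponent.sound
    rcases le_total p q with h | h
    · exact reach_all hcon (q - p) p q (by omega)
    · exact (reach_all hcon (p - q) q p (by omega)).symm
  have h1 : Nat.card G.ConnectedComponent ≤ 1 :=
    Finite.card_le_one_iff_subsingleton.2 hsub
  have hnon : Nontrivial (G.induce {u | u ≠ v}).ConnectedComponent := by
    have ha : a ≠ v := by omega
    have hc : c ≠ v := by omega
    refine ⟨SimpleGraph.connectedComponentMk _ ⟨a, ha⟩,
      SimpleGraph.connectedComponentMk _ ⟨c, hc⟩, fun e => ?_⟩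
    have hr := SimpleGraph.ConnectedComponent.exact e
    rw [SimpleGraph.reachable_iff_reflTransGen] at hr
    have key : ∀ y : {u : Fin n | u ≠ v},
        Relation.ReflTransGen (G.induce {u | u ≠ v}).Adj ⟨a, ha⟩ y → y.1 < v := by
      intro y hy
      induction hy with
      | refl => exact hav
      | @tail p q _ hpq ih =>
        have h1 : G.Adj p.1 q.1 := hpq
        have h2 : q.1 ≠ v := q.2
        by_contra h3
        exact hno _ _ ih (by omega) h1
    have := key _ hr
    simp only at this
    omega
  have h2 : 1 < Nat.card (G.induce {u | u ≠ v}).ConnectedComponent :=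
    Finite.one_lt_card_iff_nontrivial.2 hnon
  unfold IsCutVertex
  omega

theorem exists_last {n : ℕ} (G : SimpleGraph (Fin n)) (x y : Fin n) (h : G.Adj x y) :
    ∃ m, G.Adj x m ∧ y ≤ m ∧ ∀ w, G.Adj x w → w ≤ m := by
  classical
  obtain ⟨m, hm, hmax⟩ := (Finset.univ.filter (fun w => G.Adj x w)).exists_max_image id
    ⟨y, by simpa using h⟩
  simp only [Finset.mem_filter, Finset.mem_univ, true_and, id] at hm hmax
  exact ⟨m, hm, hmax y h, hmax⟩

theorem exists_first {n : ℕ} (G : SimpleGraph (Fin n)) (x y : Fin n) (h : G.Adj x y) :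
    ∃ m, G.Adj x m ∧ m ≤ y ∧ ∀ w, G.Adj x w → m ≤ w := by
  classical
  obtain ⟨m, hm, hmax⟩ := (Finset.univ.filter (fun w => G.Adj x w)).exists_min_image id
    ⟨y, by simpa using h⟩
  simp only [Finset.mem_filter, Finset.mem_univ, true_and, id] at hm hmax
  exact ⟨m, hm, hmax y h, hmax⟩

theorem OrMinus.step {n : ℕ} {G : SimpleGraph (Fin n)} {z : Fin n} {E : Fin n → Fin n → Prop}
    (hE : OrMinus G z E) {x y w : Fin n} (h : E x y) (hyw : G.Adj y w) (hw : w ≠ z)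
    (hxw : x ≠ w) (hn : ¬ G.Adj x w) : E y w := by
  rcases hE.tot y w hyw (hE.adj _ _ h).2.2 hw with h' | h'
  · exact h'
  · exact absurd (hE.inn _ _ _ h h' hxw) hn

theorem OrMinus.stepLeft {n : ℕ} {G : SimpleGraph (Fin n)} {z : Fin n}
    {E : Fin n → Fin n → Prop}
    (hE : OrMinus G z E) {x y w : Fin n} (h : E x y) (hyw : G.Adj w x) (hw : w ≠ z)
    (hxw : y ≠ w) (hn : ¬ G.Adj y w) : E w x := by
  rcases hE.tot w x hyw hw (hE.adj _ _ h).2.1 with h' | h'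
  · exact h'
  · exact absurd (hE.out _ _ _ h h' hxw) hn

theorem greedy {n : ℕ} {G : SimpleGraph (Fin n)} {z c : Fin n} {E : Fin n → Fin n → Prop}
    (hE : OrMinus G z E)
    (hcon : ∀ i j : Fin n, (j : ℕ) = i + 1 → G.Adj i j)
    (hcross : ∀ u w, u < c → c < w → ¬ G.Adj u w) :
    ∀ (d : ℕ) (x y : Fin n), (c : ℕ) - y = d → y ≤ c → x < y → z < y → E x y →
      (∀ w, G.Adj x w → w ≤ y) → ∃ x', x' < c ∧ E x' c := by
  intro d
  induction d using Nat.strong_induction_on with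
  | _ d ih =>
    intro x y hd hyc hxy hz hxE hmax
    rcases eq_or_lt_of_le hyc with e | e
    · subst e
      exact ⟨x, hxy, hxE⟩
    · have hs : (y : ℕ) + 1 < n := by have := c.2; omega
      have had : G.Adj y ⟨y + 1, hs⟩ := hcon _ _ rfl
      obtain ⟨m, hm, hle, hmm⟩ := exists_last G y _ had
      rw [Fin.le_def] at hle
      simp only at hle
      have hym : y < m := by omega
      have hmc : m ≤ c := by
        by_contra hc
        exact hcross y m e (by omega) hm
      have hn : ¬ G.Adj x m := fun h => by
        have := hmax m h
        omega
      exact ih (c - m) (by omega) y m rfl hmc hym (by omega)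
        (hE.step hxE hm (by omega) (by omega) hn) hmm

theorem extend_contra {n : ℕ} {G : SimpleGraph (Fin n)} {A : Fin n → Fin n → Prop}
    (hobs : IsObstruction G A)
    (humb : ∀ u v w : Fin n, u < v → v < w → G.Adj u w → G.Adj u v ∧ G.Adj v w)
    {a b c z x' : Fin n} (hab : a < b) (hbc : b ≤ c)
    (hcross : ∀ u w, u < c → c < w → ¬ G.Adj u w)
    (honly : ∀ x y, A x y → (x = a ∧ y = b) ∨ (c ≤ x ∧ c ≤ y))
    {E : Fin n → Fin n → Prop} (hE : OrMinus G z E)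
    (hAE : ∀ u v, A u v → u ≠ z → v ≠ z → E u v) (hz : z < c)
    (hx' : x' < c) (hxE : E x' c) : False := by
  have hcE : ∀ w, c < w → G.Adj c w → E c w := fun w hw h =>
    hE.step hxE h (by omega) (by omega) (hcross _ _ hx' hw)
  have hcr : ∀ u w, G.Adj u w → (u ≤ c ∧ w ≤ c) ∨ (c ≤ u ∧ c ≤ w) := by
    intro u w h
    by_contra hc
    by_cases h1 : u < c
    · exact hcross u w h1 (by omega) h
    · exact hcross w u (by omega) (by omega) h.symm
  have hEc : ∀ w, c ≤ w → ¬ E w c := by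
    intro w hw h
    have h1 := (hE.adj _ _ h).1
    have := h1.ne
    exact hE.asym _ _ h (hcE w (by omega) h1.symm)
  apply hobs.2.1
  refine ⟨fun u v => (G.Adj u v ∧ u < v ∧ v ≤ c) ∨ (c ≤ u ∧ c ≤ v ∧ E u v),
    ⟨?_, ?_, ?_, ?_, ?_⟩, ?_⟩
  · rintro u v (⟨h, _, _⟩ | ⟨_, _, h⟩)
    · exact h
    · exact (hE.adj _ _ h).1
  · intro u v h
    have := h.ne
    rcases hcr u v h with ⟨h1, h2⟩ | ⟨h1, h2⟩
    · rcases lt_or_gt_of_ne this with h3 | h3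
      · exact Or.inl (Or.inl ⟨h, h3, h2⟩)
      · exact Or.inr (Or.inl ⟨h.symm, h3, h1⟩)
    · rcases hE.tot u v h (by omega) (by omega) with h | h
      · exact Or.inl (Or.inr ⟨h1, h2, h⟩)
      · exact Or.inr (Or.inr ⟨h2, h1, h⟩)
  · rintro u v (⟨_, _, h⟩ | ⟨_, _, h⟩) (⟨_, _, h'⟩ | ⟨_, _, h'⟩)
    · omega
    · omega
    · omega
    · exact hE.asym _ _ h h'
  · rintro u v w (⟨h1, h2, h3⟩ | ⟨h1, h2, h⟩) (⟨h1', h2', h3'⟩ | ⟨h1', h2', h'⟩) hne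
    · rcases lt_or_gt_of_ne hne with h4 | h4
      · exact (humb u v w h2 h4 h1').2
      · exact (humb u w v h2' h4 h1).2.symm
    · omega
    · omega
    · exact hE.out _ _ _ h h' hne
  · rintro u v w (⟨h1, h2, h3⟩ | ⟨h1, h2, h⟩) (⟨h1', h2', h3'⟩ | ⟨h1', h2', h'⟩) hne
    · rcases lt_or_gt_of_ne hne with h4 | h4
      · exact (humb v w u h4 h2' h1).1
      · exact (humb w v u h4 h2 h1').1.symm
    · have : u = c := by omega
      subst this
      exact absurd h' (hEc _ h1')
    · have : u = c := by omega
      subst this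
      exact absurd h (hEc _ h1)
    · exact hE.inn _ _ _ h h' hne
  · intro u v h
    rcases honly u v h with ⟨h1, h2⟩ | ⟨h1, h2⟩
    · subst h1 h2
      exact Or.inl ⟨hobs.1.1 _ _ h, hab, hbc⟩
    · exact Or.inr ⟨h1, h2, hAE u v h (by omega) (by omega)⟩

theorem twins_contra {n : ℕ} {G : SimpleGraph (Fin n)} {A : Fin n → Fin n → Prop}
    (hobs : IsObstruction G A) {a b : Fin n} (hA : A a b)
    (htw : ∀ w, w ≠ a → w ≠ b → (G.Adj a w ↔ G.Adj b w)) : False := by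
  obtain ⟨D, ⟨d1, d2, d3, d4, d5⟩, hD⟩ := hobs.2.2.2 a b hA
  have hab := hobs.1.1 _ _ hA
  have hne := hab.ne
  have hcl : ∀ u v w : Fin n, v ≠ w → G.Adj u v → G.Adj u w →
      ((u = a ∧ v = b) ∨ (u = b ∧ v = a) ∨ (u = a ∧ w = b) ∨ (u = b ∧ w = a)) →
      G.Adj v w := by
    rintro u v w hvw h1 h2 (⟨e1, e2⟩ | ⟨e1, e2⟩ | ⟨e1, e2⟩ | ⟨e1, e2⟩)
    · subst e1 e2
      exact (htw w h2.ne' hvw.symm).1 h2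
    · subst e1 e2
      exact (htw w hvw.symm h2.ne').2 h2
    · subst e1 e2
      exact ((htw v h1.ne' hvw).1 h1).symm
    · subst e1 e2
      exact ((htw v hvw h1.ne').2 h1).symm
  apply hobs.2.1
  refine ⟨fun u v => (u = a ∧ v = b) ∨ (¬ (u = b ∧ v = a) ∧ D u v),
    ⟨?_, ?_, ?_, ?_, ?_⟩, ?_⟩
  · rintro u v (⟨h1, h2⟩ | ⟨_, h⟩)
    · subst h1 h2
      exact hab
    · exact d1 _ _ h
  · intro u v h
    have := d2 u v h
    tauto
  · rintro u v (⟨h1, h2⟩ | ⟨h1, h⟩) (⟨h1', h2'⟩ | ⟨h1', h'⟩)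
    · exact hne (h1.symm.trans h2')
    · tauto
    · tauto
    · exact d3 _ _ h h'
  · rintro u v w (⟨h1, h2⟩ | ⟨h1, h⟩) (⟨h1', h2'⟩ | ⟨h1', h'⟩) hvw
    · exact absurd (h2.trans h2'.symm) hvw
    · exact hcl u v w hvw (by rw [h1, h2]; exact hab) (d1 _ _ h') (by tauto)
    · exact hcl u v w hvw (d1 _ _ h) (by rw [h1', h2']; exact hab) (by tauto)
    · exact d4 _ _ _ h h' hvw
  · rintro u v w (⟨h1, h2⟩ | ⟨h1, h⟩) (⟨h1', h2'⟩ | ⟨h1', h'⟩) hvw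
    · exact absurd (h1.trans h1'.symm) hvw
    · exact hcl u v w hvw (by rw [h1, h2]; exact hab.symm) (d1 _ _ h').symm (by tauto)
    · exact hcl u v w hvw (d1 _ _ h).symm (by rw [h1', h2']; exact hab.symm) (by tauto)
    · exact d5 _ _ _ h h' hvw
  · intro u v h
    by_cases e : u = a ∧ v = b
    · exact Or.inl e
    · refine Or.inr ⟨?_, hD u v ⟨h, e⟩⟩
      rintro ⟨h1, h2⟩
      subst h1 h2
      exact hobs.1.2 _ _ hA h

theorem core {n : ℕ} {G : SimpleGraph (Fin n)} {A : Fin n → Fin n → Prop}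
    (hobs : IsObstruction G A)
    (humb : ∀ u v w : Fin n, u < v → v < w → G.Adj u w → G.Adj u v ∧ G.Adj v w)
    (hcon : ∀ i j : Fin n, (j : ℕ) = i + 1 → G.Adj i j)
    {a b c : Fin n} (hab : a < b) (hbc : b ≤ c) (hA : A a b)
    (hcross : ∀ u w, u < c → c < w → ¬ G.Adj u w)
    (hnc : ∀ v, a < v → v < c → ∃ u w, u < v ∧ v < w ∧ G.Adj u w)
    (honly : ∀ x y, A x y → (x = a ∧ y = b) ∨ (c ≤ x ∧ c ≤ y)) :
    ((a : ℕ) = 0 ∧ (b : ℕ) = 1 ∧ (c : ℕ) = 1) ∨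
    ((a : ℕ) = 1 ∧ (b : ℕ) = 2 ∧ (c : ℕ) = 3 ∧
      ∃ o : Fin n, (o : ℕ) = 0 ∧ G.Adj o a ∧ G.Adj b c ∧ G.Adj a c ∧ ¬ G.Adj o b ∧
        ¬ G.Adj o c) := by
  have hadj := hobs.1.1 _ _ hA
  have hn := c.2
  have hnc' : ∀ v p q : Fin n, a < v → v < c → (v : ℕ) = p + 1 → (q : ℕ) = v + 1 →
      G.Adj p q := by
    intro v p q h1 h2 h3 h4
    obtain ⟨u, w, hu, hw, h⟩ := hnc v h1 h2
    have e1 : G.Adj p w := by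
      by_cases e : u = p
      · exact e ▸ h
      · exact (humb u p w (by omega) (by omega) h).2
    by_cases e : q = w
    · exact e ▸ e1
    · exact (humb p q w (by omega) (by omega) e1).1
  rcases eq_or_lt_of_le hbc with e | hbc'
  · subst e
    left
    have : ∀ z : Fin n, z < b → z = a := by
      intro z hz
      by_contra hza
      obtain ⟨E, hE, hAE⟩ := exists_orMinus hobs z
      exact extend_contra hobs humb hab le_rfl hcross honly hE hAE hz hab
        (hAE _ _ hA (by omega) (by omega))
    have h0 := this ⟨0, by omega⟩ (by rw [Fin.lt_def]; simp only; omega)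
    have h1 := this ⟨b - 1, by omega⟩ (by rw [Fin.lt_def]; simp only; omega)
    have h0' := congrArg Fin.val h0
    have h1' := congrArg Fin.val h1
    simp only at h0' h1'
    omega
  right
  have hs : (b : ℕ) + 1 < n := by omega
  have had : G.Adj b ⟨b + 1, hs⟩ := hcon _ _ rfl
  obtain ⟨m, hm, hle, hmm⟩ := exists_last G b _ had
  rw [Fin.le_def] at hle
  simp only at hle
  have hmc : m ≤ c := by
    by_contra hc
    exact hcross b m hbc' (by omega) hm
  by_cases ham : G.Adj a m
  · have hlast : ∀ w, G.Adj a w → w ≤ m := by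
      intro w hw
      by_contra hc
      have := hmm w (humb a b w hab (by omega) hw).2
      omega
    by_cases hl : ∃ l, l < a ∧ G.Adj l a ∧ ¬ G.Adj l b
    · obtain ⟨l, hla, hlA, hlb⟩ := hl
      have hlm : ¬ G.Adj l m := fun h => hlb (humb l b m (by omega) (by omega) h).1
      have hall : ∀ z : Fin n, z < m → z = l ∨ z = a ∨ z = b := by
        intro z hz
        by_contra hcz
        obtain ⟨E, hE, hAE⟩ := exists_orMinus hobs z
        have e1 := hAE _ _ hA (by omega) (by omega)
        have e2 : E l a := hE.stepLeft e1 hlA (by omega) (by omega) (fun h => hlb h.symm)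
        have e3 : E a m := hE.step e2 ham (by omega) (by omega) hlm
        obtain ⟨x', hx', hx'E⟩ := greedy hE hcon hcross _ a m rfl hmc (by omega) hz e3 hlast
        exact extend_contra hobs humb hab hbc hcross honly hE hAE (by omega) hx' hx'E
      have hall' : ∀ k : ℕ, k < m → k = l ∨ k = a ∨ k = b := by
        intro k hk
        have := hall ⟨k, by omega⟩ (by rw [Fin.lt_def]; exact hk)
        simpa only [Fin.ext_iff] using this
      have k0 := hall' 0 (by omega)
      have k1 := hall' 1 (by omega)
      have k2 := hall' 2 (by omega)
      have v0 : (l : ℕ) = 0 := by omega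
      have v1 : (a : ℕ) = 1 := by omega
      have v2 : (b : ℕ) = 2 := by omega
      have v3 : (m : ℕ) = 3 := by
        by_contra h
        have := hall' 3 (by omega)
        omega
      have hcm : m = c := by
        by_contra h
        have h4 : (m : ℕ) + 1 < n := by omega
        have := hmm _ (hnc' m b ⟨m + 1, h4⟩ (by omega) (by omega) (by omega) rfl)
        rw [Fin.le_def] at this
        simp only at this
        omega
      subst hcm
      exact ⟨v1, v2, v3, l, v0, hlA, hm, ham, hlb, hlm⟩
    · exfalso
      push Not at hl
      refine twins_contra hobs hA (fun w hwa hwb => ⟨fun h => ?_, fun h => ?_⟩)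
      · rcases lt_or_gt_of_ne hwa with h1 | h1
        · exact (hl w h1 h.symm).symm
        · rcases lt_or_gt_of_ne hwb with h2 | h2
          · exact (humb a w b h1 h2 hadj).2.symm
          · exact (humb a b w hab h2 h).2
      · rcases lt_or_gt_of_ne hwa with h1 | h1
        · exact (humb w a b h1 hab h.symm).1.symm
        · rcases lt_or_gt_of_ne hwb with h2 | h2
          · exact (humb a w b h1 h2 hadj).1
          · have := hmm w h
            by_cases e : w = m
            · exact e ▸ ham
            · exact (humb a w m h1 (by omega) ham).1
  · exfalso
    have hall : ∀ z : Fin n, z < m → z = a ∨ z = b := by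
      intro z hz
      by_contra hcz
      obtain ⟨E, hE, hAE⟩ := exists_orMinus hobs z
      have e1 := hAE _ _ hA (by omega) (by omega)
      have e3 : E b m := hE.step e1 hm (by omega) (by omega) ham
      obtain ⟨x', hx', hx'E⟩ := greedy hE hcon hcross _ b m rfl hmc (by omega) hz e3 hmm
      exact extend_contra hobs humb hab hbc hcross honly hE hAE (by omega) hx' hx'E
    have hall' : ∀ k : ℕ, k < m → k = a ∨ k = b := by
      intro k hk
      have := hall ⟨k, by omega⟩ (by rw [Fin.lt_def]; exact hk)
      simpa only [Fin.ext_iff] using this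
    have k0 := hall' 0 (by omega)
    have k1 := hall' 1 (by omega)
    have v2 : (m : ℕ) = 2 := by
      by_contra h
      have := hall' 2 (by omega)
      omega
    exact ham (hnc' b a m hab hbc' (by omega) (by omega))

theorem core_any {n : ℕ} {G : SimpleGraph (Fin n)} {A : Fin n → Fin n → Prop}
    (hobs : IsObstruction G A)
    (humb : ∀ u v w : Fin n, u < v → v < w → G.Adj u w → G.Adj u v ∧ G.Adj v w)
    {a₁ b₁ a₂ b₂ c : Fin n} (h1 : A a₁ b₁) (h2 : A a₂ b₂)
    (honly : ∀ x y, A x y → (x = a₁ ∧ y = b₁) ∨ (x = a₂ ∧ y = b₂))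
    (hcut : IsCutVertex G c)
    (hd1 : a₁ < c ∨ b₁ < c) (hd2 : c < a₂ ∨ c < b₂)
    (hfirst : ∀ c' : Fin n, c' < c → IsCutVertex G c' →
      ¬ ((a₁ < c' ∨ b₁ < c') ∧ (c' < a₂ ∨ c' < b₂))) :
    (∃ (h0 : 0 < n) (h1' : 1 < n), (c : ℕ) = 1 ∧
      (A ⟨0, h0⟩ ⟨1, h1'⟩ ∨ A ⟨1, h1'⟩ ⟨0, h0⟩)) ∨
    (∃ (h0 : 0 < n) (h1' : 1 < n) (h2' : 2 < n) (h3' : 3 < n), (c : ℕ) = 3 ∧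
      (A ⟨1, h1'⟩ ⟨2, h2'⟩ ∨ A ⟨2, h2'⟩ ⟨1, h1'⟩) ∧
      G.Adj ⟨0, h0⟩ ⟨1, h1'⟩ ∧ G.Adj ⟨1, h1'⟩ ⟨2, h2'⟩ ∧
      G.Adj ⟨2, h2'⟩ ⟨3, h3'⟩ ∧ G.Adj ⟨1, h1'⟩ ⟨3, h3'⟩ ∧
      ¬ G.Adj ⟨0, h0⟩ ⟨2, h2'⟩ ∧ ¬ G.Adj ⟨0, h0⟩ ⟨3, h3'⟩) := by
  have hcon := obstruction_consec hobs humb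
  have hcross := cut_no_cross hcon c hcut
  have g1 := hobs.1.1 _ _ h1
  have g2 := hobs.1.1 _ _ h2
  have hle1 : a₁ ≤ c ∧ b₁ ≤ c := by
    by_contra h
    by_cases h' : a₁ < c
    · exact hcross a₁ b₁ h' (by omega) g1
    · exact hcross b₁ a₁ (by omega) (by omega) g1.symm
  have hle2 : c ≤ a₂ ∧ c ≤ b₂ := by
    by_contra h
    by_cases h' : a₂ < c
    · exact hcross a₂ b₂ h' (by omega) g2
    · exact hcross b₂ a₂ (by omega) (by omega) g2.symm
  have hnc : ∀ v, (a₁ < v ∨ b₁ < v) → v < c → ∃ u w, u < v ∧ v < w ∧ G.Adj u w := by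
    intro v hv hvc
    by_contra hno
    push Not at hno
    have hcv : IsCutVertex G v := by
      rcases hv with hv | hv
      · exact cut_of_no_cross hcon a₁ v c hv hvc hno
      · exact cut_of_no_cross hcon b₁ v c hv hvc hno
    exact hfirst v hvc hcv ⟨hv, by omega⟩
  have fin : ∀ a b : Fin n, (A a b ∨ A b a) →
      (((a : ℕ) = 0 ∧ (b : ℕ) = 1 ∧ (c : ℕ) = 1) ∨
    ((a : ℕ) = 1 ∧ (b : ℕ) = 2 ∧ (c : ℕ) = 3 ∧
      ∃ o : Fin n, (o : ℕ) = 0 ∧ G.Adj o a ∧ G.Adj b c ∧ G.Adj a c ∧ ¬ G.Adj o b ∧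
        ¬ G.Adj o c)) → (∃ (h0 : 0 < n) (h1' : 1 < n), (c : ℕ) = 1 ∧
      (A ⟨0, h0⟩ ⟨1, h1'⟩ ∨ A ⟨1, h1'⟩ ⟨0, h0⟩)) ∨
    (∃ (h0 : 0 < n) (h1' : 1 < n) (h2' : 2 < n) (h3' : 3 < n), (c : ℕ) = 3 ∧
      (A ⟨1, h1'⟩ ⟨2, h2'⟩ ∨ A ⟨2, h2'⟩ ⟨1, h1'⟩) ∧
      G.Adj ⟨0, h0⟩ ⟨1, h1'⟩ ∧ G.Adj ⟨1, h1'⟩ ⟨2, h2'⟩ ∧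
      G.Adj ⟨2, h2'⟩ ⟨3, h3'⟩ ∧ G.Adj ⟨1, h1'⟩ ⟨3, h3'⟩ ∧
      ¬ G.Adj ⟨0, h0⟩ ⟨2, h2'⟩ ∧ ¬ G.Adj ⟨0, h0⟩ ⟨3, h3'⟩) := by
    have hn := c.2
    rintro a b hA (⟨e1, e2, e3⟩ | ⟨e1, e2, e3, o, e0, k1, k2, k3, k4, k5⟩)
    · left
      refine ⟨by omega, by omega, e3, ?_⟩
      have ea : a = ⟨0, by omega⟩ := Fin.ext e1
      have eb : b = ⟨1, by omega⟩ := Fin.ext e2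
      rw [← ea, ← eb]
      exact hA
    · right
      refine ⟨by omega, by omega, by omega, by omega, e3, ?_⟩
      have eo : o = ⟨0, by omega⟩ := Fin.ext e0
      have ea : a = ⟨1, by omega⟩ := Fin.ext e1
      have eb : b = ⟨2, by omega⟩ := Fin.ext e2
      have ec : c = ⟨3, by omega⟩ := Fin.ext e3
      rw [← eo, ← ea, ← eb, ← ec]
      exact ⟨hA, k1, hcon a b (by omega), k2, k3, k4, k5⟩
  rcases lt_or_gt_of_ne g1.ne with hlt | hlt
  · refine fin a₁ b₁ (Or.inl h1) (core hobs humb hcon hlt hle1.2 h1 hcross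
      (fun v hv => hnc v (Or.inl hv)) ?_)
    intro x y h
    rcases honly x y h with h | ⟨e1, e2⟩
    · exact Or.inl h
    · subst e1 e2
      exact Or.inr hle2
  · refine fin b₁ a₁ (Or.inr h1) (core (obstruction_flip hobs) humb hcon hlt hle1.1 h1 hcross
      (fun v hv => hnc v (Or.inr hv)) ?_)
    intro x y h
    rcases honly y x h with h | ⟨e1, e2⟩
    · exact Or.inl h.symm
    · subst e1 e2
      exact Or.inr hle2.symm

/-- If v_c is the first dividing cut-vertex of an obstruction with straight
enumeration v_0, ..., v_{n-1} (the natural order on Fin n), then either c = 1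
and v_0, v_1 are the endvertices of an arc, or c = 3, v_1 and v_2 are the
endvertices of an arc, and v_0, v_1, v_2, v_3 induce the graph with edges
v_0v_1, v_1v_2, v_2v_3 and v_1v_3. -/
theorem first_dividing_cut_vertex (n : ℕ) (G : SimpleGraph (Fin n))
    (A : Fin n → Fin n → Prop) (hobs : IsObstruction G A)
    (humb : ∀ u v w : Fin n, u < v → v < w → G.Adj u w → G.Adj u v ∧ G.Adj v w)
    (a₁ b₁ a₂ b₂ : Fin n) (h1 : A a₁ b₁) (h2 : A a₂ b₂)
    (hne : (a₁, b₁) ≠ (a₂, b₂))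
    (honly : ∀ x y, A x y → (x = a₁ ∧ y = b₁) ∨ (x = a₂ ∧ y = b₂))
    (c : Fin n) (hcut : IsCutVertex G c) (hdiv : IsDividing a₁ b₁ a₂ b₂ c)
    (hfirst : ∀ c' : Fin n, c' < c → IsCutVertex G c' →
      ¬ IsDividing a₁ b₁ a₂ b₂ c') :
    (∃ (h0 : 0 < n) (h1' : 1 < n), (c : ℕ) = 1 ∧
      (A ⟨0, h0⟩ ⟨1, h1'⟩ ∨ A ⟨1, h1'⟩ ⟨0, h0⟩)) ∨
    (∃ (h0 : 0 < n) (h1' : 1 < n) (h2' : 2 < n) (h3' : 3 < n), (c : ℕ) = 3 ∧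
      (A ⟨1, h1'⟩ ⟨2, h2'⟩ ∨ A ⟨2, h2'⟩ ⟨1, h1'⟩) ∧
      G.Adj ⟨0, h0⟩ ⟨1, h1'⟩ ∧ G.Adj ⟨1, h1'⟩ ⟨2, h2'⟩ ∧
      G.Adj ⟨2, h2'⟩ ⟨3, h3'⟩ ∧ G.Adj ⟨1, h1'⟩ ⟨3, h3'⟩ ∧
      ¬ G.Adj ⟨0, h0⟩ ⟨2, h2'⟩ ∧ ¬ G.Adj ⟨0, h0⟩ ⟨3, h3'⟩) := by
  rcases hdiv with ⟨d1, d2⟩ | ⟨d1, d2⟩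
  · exact core_any hobs humb h1 h2 honly hcut d1 d2
      (fun c' h h' h'' => hfirst c' h h' (Or.inl h''))
  · exact core_any hobs humb h2 h1 (fun x y h => (honly x y h).symm) hcut d1 d2
      (fun c' h h' h'' => hfirst c' h h' (Or.inr h''))
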